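/- Suppose {q_n} is a sequence of positive reals such that β = lim_{n→∞} n(1−q_n) exists in ℝ, and {a_n} is a sequence with a_n ∈ {1,…,n} and lim_{n→∞} a_n/n = a. Write u(x,y) = u(x,y,β). Then: (i) for any 0 ≤ y₁ < y₂ < 1, lim_{ε→0⁺} limsup_{n→∞} | μ_{n,q_n}(π(a_n)/n ∈ (y₂, y₂+ε)) / μ_{n,q_n}(π(a_n)/n ∈ (y₁, y₁+ε)) − u(a,y₂)/u(a,y₁) | = 0; and (ii) for any 0 < y₁ < y₂ ≤ 1, lim_{ε→0⁺} limsup_{n→∞} | μ_{n,q_n}(π(a_n)/n ∈ (y₂−ε, y₂)) / μ_{n,q_n}(π(a_n)/n ∈ (y₁−ε, y₁)) − u(a,y₂)/u(a,y₁) | = 0. -/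

import Mathlib

open Filter Finset MeasureTheory

/-- Number of inversions of a permutation of `Fin n`. -/
def inversions (n : ℕ) (π : Equiv.Perm (Fin n)) : ℕ :=
  (Finset.univ.filter (fun p : Fin n × Fin n => p.1 < p.2 ∧ π p.2 < π p.1)).card

/-- The `(n,q)`-Mallows probability mass function on `S_n`. -/
noncomputable def mallowsPMF (n : ℕ) (q : ℝ) (π : Equiv.Perm (Fin n)) : ℝ :=
  q ^ inversions n π / ∑ σ : Equiv.Perm (Fin n), q ^ inversions n σ

open Classical in
/-- The `(n,q)`-Mallows probability of an event `P` of permutations. -/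
noncomputable def mallowsProb (n : ℕ) (q : ℝ) (P : Equiv.Perm (Fin n) → Prop) : ℝ :=
  ∑ π : Equiv.Perm (Fin n), if P π then mallowsPMF n q π else 0

/-- Expectation with respect to the `(n,q)`-Mallows measure. -/
noncomputable def mallowsExp (n : ℕ) (q : ℝ) (f : Equiv.Perm (Fin n) → ℝ) : ℝ :=
  ∑ π : Equiv.Perm (Fin n), mallowsPMF n q π * f π

/-- Action of a permutation of `Fin n` on one-based indices `{1,…,n}`. -/
def permAct (n : ℕ) (π : Equiv.Perm (Fin n)) (i : ℕ) : ℕ :=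
  if h : 1 ≤ i ∧ i ≤ n then ((π ⟨i - 1, by omega⟩ : Fin n) : ℕ) + 1 else i

/-- The limiting density `u(x,y,β)` from Starr's theorem. -/
noncomputable def mallowsU (x y β : ℝ) : ℝ :=
  if β = 0 then 1
  else (β / 2) * Real.sinh (β / 2) /
    (Real.exp (β / 4) * Real.cosh (β * (x - y) / 2)
      - Real.exp (-β / 4) * Real.cosh (β * (x + y - 1) / 2)) ^ 2

/-- The `q`-number `[k]_q = 1 + q + ⋯ + q ^ (k - 1)`. -/
noncomputable def qNum (q : ℝ) (k : ℕ) : ℝ := ∑ l ∈ Finset.range k, q ^ l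

lemma qNum_zero (q : ℝ) : qNum q 0 = 0 := by simp [qNum]

lemma qNum_one (q : ℝ) : qNum q 1 = 1 := by simp [qNum]

lemma qNum_succ (q : ℝ) (k : ℕ) : qNum q (k + 1) = 1 + q * qNum q k := by
  simp only [qNum]
  rw [Finset.sum_range_succ', Finset.mul_sum, pow_zero, add_comm]
  simp only [pow_succ']

lemma qNum_add (q : ℝ) (k l : ℕ) : qNum q (k + l) = qNum q k + q ^ k * qNum q l := by
  simp only [qNum, Finset.sum_range_add, Finset.mul_sum, pow_add]

lemma pow_eq_one_sub_mul_qNum (q : ℝ) (k : ℕ) : q ^ k = 1 - (1 - q) * qNum q k := by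
  have := geom_sum_mul q k
  simp only [qNum]
  linear_combination -this

lemma qNum_nonneg {q : ℝ} (hq : 0 < q) (k : ℕ) : 0 ≤ qNum q k :=
  Finset.sum_nonneg fun _ _ => by positivity

lemma qNum_mono {q : ℝ} (hq : 0 < q) {k l : ℕ} (h : k ≤ l) : qNum q k ≤ qNum q l := by
  obtain ⟨m, rfl⟩ := Nat.exists_eq_add_of_le h
  rw [qNum_add]
  have := qNum_nonneg hq m
  have : 0 ≤ q ^ k * qNum q m := by positivity
  linarith

lemma qNum_pos {q : ℝ} (hq : 0 < q) {k : ℕ} (hk : 0 < k) : 0 < qNum q k := by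
  have := qNum_mono hq (show 1 ≤ k from hk)
  rw [qNum_one] at this
  linarith

lemma mallows_partition_pos {q : ℝ} (hq : 0 < q) (n : ℕ) :
    0 < ∑ σ : Equiv.Perm (Fin n), q ^ inversions n σ :=
  Finset.sum_pos (fun _ _ => by positivity) Finset.univ_nonempty

lemma mallowsPMF_nonneg {q : ℝ} (hq : 0 < q) (n : ℕ) (π : Equiv.Perm (Fin n)) :
    0 ≤ mallowsPMF n q π :=
  div_nonneg (by positivity) (mallows_partition_pos hq n).le

lemma sum_mallowsPMF {q : ℝ} (hq : 0 < q) (n : ℕ) :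
    ∑ π : Equiv.Perm (Fin n), mallowsPMF n q π = 1 := by
  simp only [mallowsPMF, ← Finset.sum_div]
  exact div_self (mallows_partition_pos hq n).ne'

/-- The permutation of `Fin (n + 1)` sending `0` to `p` and acting on the remaining points in the
relative order prescribed by `σ`. -/
def permCons {n : ℕ} (x : Fin (n + 1) × Equiv.Perm (Fin n)) : Equiv.Perm (Fin (n + 1)) :=
  (Equiv.Perm.decomposeFin.symm (0, x.2)).trans x.1.cycleRange.symm

lemma permCons_zero {n : ℕ} (p : Fin (n + 1)) (σ : Equiv.Perm (Fin n)) :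
    permCons (p, σ) 0 = p := by
  simp [permCons]

lemma permCons_succ {n : ℕ} (p : Fin (n + 1)) (σ : Equiv.Perm (Fin n)) (k : Fin n) :
    permCons (p, σ) k.succ = p.succAbove (σ k) := by
  simp [permCons]

lemma permCons_bijective (n : ℕ) :
    Function.Bijective (permCons (n := n)) := by
  rw [Fintype.bijective_iff_injective_and_card]
  constructor
  · rintro ⟨p, σ⟩ ⟨p', σ'⟩ h
    have h0 : p = p' := by rw [← permCons_zero p σ, h, permCons_zero]
    subst h0
    congr 1
    ext k
    have := permCons_succ p σ k
    rw [h, permCons_succ] at this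
    rw [Fin.succAbove_right_injective this]
  · simp [Fintype.card_perm, Nat.factorial_succ]

lemma card_succAbove_lt {n : ℕ} (p : Fin (n + 1)) :
    ∑ k : Fin n, (if p.succAbove k < p then 1 else 0) = (p : ℕ) := by
  have h : ∑ k : Fin (n + 1), (if k < p then 1 else 0) = (p : ℕ) := by
    rw [← Finset.sum_filter]
    simp [Finset.filter_gt_eq_Iio]
  rw [Fin.sum_univ_succAbove _ p] at h
  simpa using h

lemma inversions_permCons {n : ℕ} (p : Fin (n + 1)) (σ : Equiv.Perm (Fin n)) :
    inversions (n + 1) (permCons (p, σ)) = p + inversions n σ := by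
  have key : ∀ (m : ℕ) (τ : Equiv.Perm (Fin m)),
      inversions m τ = ∑ i, ∑ j, if i < j ∧ τ j < τ i then 1 else 0 := by
    intro m τ
    rw [inversions, Finset.card_filter, ← Finset.univ_product_univ, Finset.sum_product]
  rw [key, key, Fin.sum_univ_succ]
  congr 1
  · rw [Fin.sum_univ_succ]
    simp only [permCons_zero, permCons_succ, Fin.succ_pos, true_and, lt_irrefl, false_and,
      if_false, zero_add]
    rw [Equiv.sum_comp σ (fun k => if p.succAbove k < p then 1 else 0)]
    exact card_succAbove_lt p
  · refine Finset.sum_congr rfl fun i _ => ?_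
    rw [Fin.sum_univ_succ]
    simp [permCons_succ]

lemma sum_perm_succ {n : ℕ} (f : Equiv.Perm (Fin (n + 1)) → ℝ) :
    ∑ π, f π = ∑ p, ∑ σ, f (permCons (p, σ)) := by
  rw [← (Equiv.ofBijective _ (permCons_bijective n)).sum_comp, Fintype.sum_prod_type]
  rfl

lemma mallows_partition_succ (n : ℕ) (q : ℝ) :
    ∑ σ : Equiv.Perm (Fin (n + 1)), q ^ inversions (n + 1) σ =
      qNum q (n + 1) * ∑ σ : Equiv.Perm (Fin n), q ^ inversions n σ := by
  rw [sum_perm_succ]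
  simp only [inversions_permCons, pow_add, ← Finset.mul_sum]
  rw [← Finset.sum_mul, Fin.sum_univ_eq_sum_range (fun l => q ^ l), ← qNum]

lemma mallowsExp_succ (n : ℕ) (q : ℝ) (f : Equiv.Perm (Fin (n + 1)) → ℝ) :
    mallowsExp (n + 1) q f =
      ∑ p : Fin (n + 1), q ^ (p : ℕ) / qNum q (n + 1) *
        mallowsExp n q (fun σ => f (permCons (p, σ))) := by
  simp only [mallowsExp, mallowsPMF]
  rw [sum_perm_succ, mallows_partition_succ]
  refine Finset.sum_congr rfl fun p _ => ?_
  conv_rhs => rw [Finset.mul_sum]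
  refine Finset.sum_congr rfl fun σ _ => ?_
  rw [inversions_permCons, pow_add, mul_div_mul_comm, mul_assoc]

/-- The number of the first `i` points that `π` sends to one of the first `j` points. -/
def initialCount {n : ℕ} (i j : ℕ) (π : Equiv.Perm (Fin n)) : ℕ :=
  ∑ k : Fin n, if (k : ℕ) < i ∧ (π k : ℕ) < j then 1 else 0

lemma initialCount_zero {n : ℕ} (j : ℕ) (π : Equiv.Perm (Fin n)) : initialCount 0 j π = 0 := by
  simp [initialCount]

lemma initialCount_succ_permCons {n : ℕ} (i j : ℕ) (p : Fin (n + 1)) (σ : Equiv.Perm (Fin n)) :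
    initialCount (i + 1) j (permCons (p, σ)) =
      if (p : ℕ) < j then initialCount i (j - 1) σ + 1 else initialCount i j σ := by
  simp only [initialCount]
  rw [Fin.sum_univ_succ]
  simp only [permCons_zero, permCons_succ]
  have hs : ∀ k : Fin n, ((p.succAbove k : Fin (n + 1)) : ℕ) =
      if (k : ℕ) < p then (k : ℕ) else k + 1 := by
    intro k
    simp only [Fin.succAbove, Fin.lt_def, Fin.val_castSucc]
    split_ifs <;> simp
  simp only [hs]
  by_cases h : (p : ℕ) < j
  · rw [add_comm]
    simp only [Fin.val_zero, Nat.succ_pos, true_and, h, if_true]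
    congr 1
    refine Finset.sum_congr rfl fun k _ => ?_
    congr 1
    simp only [Fin.val_succ, eq_iff_iff]
    split_ifs <;> omega
  · simp only [h, and_false, if_false, zero_add]
    refine Finset.sum_congr rfl fun k _ => ?_
    congr 1
    simp only [Fin.val_succ, eq_iff_iff]
    split_ifs <;> omega

lemma initialCount_le {n : ℕ} (i j : ℕ) (π : Equiv.Perm (Fin n)) : initialCount i j π ≤ j := by
  have h1 : initialCount i j π ≤ ∑ k : Fin n, if ((π k : Fin n) : ℕ) < j then 1 else 0 := by
    refine Finset.sum_le_sum fun k _ => ?_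
    split_ifs <;> simp_all
  rw [Equiv.sum_comp π (fun k : Fin n => if (k : ℕ) < j then 1 else 0),
    Fin.sum_univ_eq_sum_range (fun k => if k < j then 1 else 0), ← Finset.sum_filter,
    ← Finset.card_eq_sum_ones] at h1
  refine h1.trans ?_
  calc _ ≤ (Finset.range j).card := Finset.card_le_card fun k hk => by simp_all
    _ = j := by simp

/-- Conditioning on the image of the first point. -/
lemma mallowsExp_initialCount_succ {n : ℕ} {q : ℝ} (hq : 0 < q) (i : ℕ) {j : ℕ} (hj : j ≤ n + 1)
    (f : ℕ → ℝ) :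
    mallowsExp (n + 1) q (fun π => f (initialCount (i + 1) j π)) =
      qNum q j / qNum q (n + 1) * mallowsExp n q (fun π => f (initialCount i (j - 1) π + 1)) +
      (1 - qNum q j / qNum q (n + 1)) * mallowsExp n q (fun π => f (initialCount i j π)) := by
  have hpos : qNum q (n + 1) ≠ 0 := (qNum_pos hq n.succ_pos).ne'
  rw [mallowsExp_succ]
  simp only [initialCount_succ_permCons]
  have h1 : ∀ p : Fin (n + 1), q ^ (p : ℕ) / qNum q (n + 1) * mallowsExp n q (fun σ =>
      f (if (p : ℕ) < j then initialCount i (j - 1) σ + 1 else initialCount i j σ)) =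
      (if (p : ℕ) < j then q ^ (p : ℕ) else 0) *
        ((mallowsExp n q (fun π => f (initialCount i (j - 1) π + 1)) -
          mallowsExp n q (fun π => f (initialCount i j π))) / qNum q (n + 1)) +
      q ^ (p : ℕ) * (mallowsExp n q (fun π => f (initialCount i j π)) / qNum q (n + 1)) := by
    intro p
    split_ifs <;> ring
  rw [Finset.sum_congr rfl fun p _ => h1 p, Finset.sum_add_distrib, ← Finset.sum_mul,
    ← Finset.sum_mul, Fin.sum_univ_eq_sum_range (fun l => q ^ l),
    Fin.sum_univ_eq_sum_range (fun l => if l < j then q ^ l else 0), ← Finset.sum_filter]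
  have h2 : (Finset.range (n + 1)).filter (· < j) = Finset.range j := by
    ext; simp; omega
  rw [h2]
  change qNum q j * _ + qNum q (n + 1) * _ = _
  field_simp
  ring

lemma mallowsExp_add (n : ℕ) (q : ℝ) (f g : Equiv.Perm (Fin n) → ℝ) :
    mallowsExp n q (fun π => f π + g π) = mallowsExp n q f + mallowsExp n q g := by
  simp [mallowsExp, mul_add, Finset.sum_add_distrib]

lemma mallowsExp_const_mul (n : ℕ) (q c : ℝ) (f : Equiv.Perm (Fin n) → ℝ) :
    mallowsExp n q (fun π => c * f π) = c * mallowsExp n q f := by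
  simp only [mallowsExp, Finset.mul_sum]
  exact Finset.sum_congr rfl fun _ _ => by ring

lemma mallowsExp_sub (n : ℕ) (q : ℝ) (f g : Equiv.Perm (Fin n) → ℝ) :
    mallowsExp n q (fun π => f π - g π) = mallowsExp n q f - mallowsExp n q g := by
  simp [mallowsExp, mul_sub, Finset.sum_sub_distrib]

lemma mallowsExp_const {q : ℝ} (hq : 0 < q) (n : ℕ) (c : ℝ) :
    mallowsExp n q (fun _ => c) = c := by
  rw [mallowsExp, ← Finset.sum_mul, sum_mallowsPMF hq, one_mul]

lemma mallowsExp_mono {q : ℝ} (hq : 0 < q) (n : ℕ) {f g : Equiv.Perm (Fin n) → ℝ}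
    (h : ∀ π, f π ≤ g π) : mallowsExp n q f ≤ mallowsExp n q g :=
  Finset.sum_le_sum fun π _ => mul_le_mul_of_nonneg_left (h π) (mallowsPMF_nonneg hq n π)

/-- The `q`-analogue of the hypergeometric mean. -/
lemma mallowsExp_qNum_initialCount {q : ℝ} (hq : 0 < q) {n i j : ℕ} (hi : i ≤ n) (hj : j ≤ n) :
    mallowsExp n q (fun π => qNum q (initialCount i j π)) =
      qNum q i * qNum q j / qNum q n := by
  induction n generalizing i j with
  | zero =>
    obtain rfl : i = 0 := by omega
    simp [initialCount_zero, qNum_zero, mallowsExp]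
  | succ n ih =>
    have hpos : qNum q (n + 1) ≠ 0 := (qNum_pos hq n.succ_pos).ne'
    cases i with
    | zero => simp [initialCount_zero, qNum_zero, mallowsExp]
    | succ i =>
      rw [mallowsExp_initialCount_succ hq i hj (qNum q)]
      simp only [qNum_succ q (initialCount _ _ _)]
      rw [mallowsExp_add, mallowsExp_const hq, mallowsExp_const_mul, ih (by omega) (by omega)]
      cases j with
      | zero => rw [ih (by omega) (by omega)]; simp [qNum_zero]
      | succ j =>
        rcases hj.eq_or_lt with hj | hj
        · obtain rfl : j = n := by omega
          rcases Nat.eq_zero_or_pos j with rfl | hn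
          · obtain rfl : i = 0 := by omega
            simp [qNum_zero, qNum_one]
          · have : qNum q j ≠ 0 := (qNum_pos hq hn).ne'
            simp only [Nat.add_sub_cancel, div_self hpos, qNum_succ q i]
            field_simp
            ring
        · rw [ih (by omega) (by omega)]
          have : qNum q n ≠ 0 := (qNum_pos hq (by omega)).ne'
          simp only [Nat.add_sub_cancel]
          rw [qNum_succ q n] at *
          rw [qNum_succ q i, qNum_succ q j]
          field_simp
          ring

/-- The `q`-analogue of the second factorial moment of the hypergeometric distribution. -/
lemma mallowsExp_qNum_mul_qNum_initialCount {q : ℝ} (hq : 0 < q) {n i j : ℕ}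
    (hi : i ≤ n) (hj : j ≤ n) :
    mallowsExp n q (fun π => qNum q (initialCount i j π) * (qNum q (initialCount i j π) - 1)) =
      qNum q i * (qNum q i - 1) * (qNum q j * (qNum q j - 1)) /
        (qNum q n * (qNum q n - 1)) := by
  induction n generalizing i j with
  | zero =>
    obtain rfl : i = 0 := by omega
    simp [initialCount_zero, qNum_zero, mallowsExp]
  | succ n ih =>
    have hpos : qNum q (n + 1) ≠ 0 := (qNum_pos hq n.succ_pos).ne'
    cases i with
    | zero => simp [initialCount_zero, qNum_zero, mallowsExp]
    | succ i =>
      have hrec : ∀ k, qNum q (k + 1) * (qNum q (k + 1) - 1) =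
          (q + q ^ 2) * qNum q k + q ^ 2 * (qNum q k * (qNum q k - 1)) := by
        intro k
        rw [qNum_succ]
        ring
      rw [mallowsExp_initialCount_succ hq i hj (fun k => qNum q k * (qNum q k - 1))]
      simp only [hrec (initialCount _ _ _)]
      rw [mallowsExp_add, mallowsExp_const_mul, mallowsExp_const_mul,
        mallowsExp_qNum_initialCount hq (by omega) (by omega), ih (by omega) (by omega)]
      cases j with
      | zero => rw [ih (by omega) (by omega)]; simp [qNum_zero]
      | succ j =>
        rcases Nat.eq_zero_or_pos n with rfl | hn
        · obtain rfl : i = 0 := by omega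
          obtain rfl : j = 0 := by omega
          simp [qNum_zero, qNum_one]
        have hn' : qNum q n ≠ 0 := (qNum_pos hq hn).ne'
        simp only [Nat.add_sub_cancel]
        obtain ⟨m, rfl⟩ : ∃ m, n = m + 1 := ⟨n - 1, by omega⟩
        have hq' := hq.ne'
        have e1 : qNum q (m + 1 + 1) - 1 = q * qNum q (m + 1) := by rw [qNum_succ]; ring
        have e2 : qNum q (m + 1) - 1 = q * qNum q m := by rw [qNum_succ]; ring
        have e3 : ∀ k, qNum q (k + 1) - 1 = q * qNum q k := fun k => by rw [qNum_succ]; ring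
        rw [e1, e2, e3 i, e3 j]
        rcases hj.eq_or_lt with hj | hj
        · obtain rfl : j = m + 1 := by omega
          rw [div_self hpos, e2]
          rcases Nat.eq_zero_or_pos m with rfl | hm
          · have hi' : qNum q i * (qNum q i - 1) = 0 := by
              have : i ≤ 1 := by omega
              interval_cases i <;> simp [qNum_zero, qNum_one]
            simp only [hi', qNum_zero, qNum_succ]
            field_simp
            linear_combination (-q ^ 2) * hi'
          · have hm' : qNum q m ≠ 0 := (qNum_pos hq hm).ne'
            field_simp
            rw [qNum_succ q i]
            ring
        · rw [ih (by omega) (by omega), e2]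
          rcases Nat.eq_zero_or_pos m with rfl | hm
          · have hi' : qNum q i * (qNum q i - 1) = 0 := by
              have : i ≤ 1 := by omega
              interval_cases i <;> simp [qNum_zero, qNum_one]
            obtain rfl : j = 0 := by omega
            simp only [hi', qNum_zero, qNum_succ]
            simp
          · have hm' : qNum q m ≠ 0 := (qNum_pos hq hm).ne'
            rw [qNum_succ q (m + 1)] at *
            rw [qNum_succ q m] at *
            rw [qNum_succ q i, qNum_succ q j]
            field_simp
            ring

/-- Conditioning on the first `i` images. -/
lemma mallowsExp_initialCount_sub {q : ℝ} (hq : 0 < q) {n i j : ℕ} (hi : i < n) (hj : j ≤ n) :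
    mallowsExp n q (fun π => (initialCount (i + 1) j π : ℝ)) -
      mallowsExp n q (fun π => (initialCount i j π : ℝ)) =
      mallowsExp n q (fun π => qNum q (j - initialCount i j π)) / qNum q (n - i) := by
  induction n generalizing i j with
  | zero => omega
  | succ n ih =>
    have hpos : qNum q (n + 1) ≠ 0 := (qNum_pos hq n.succ_pos).ne'
    cases i with
    | zero =>
      rw [mallowsExp_initialCount_succ hq 0 hj (fun k => (k : ℝ))]
      simp [initialCount_zero, mallowsExp_const hq]
    | succ i =>
      rw [mallowsExp_initialCount_succ hq i hj (fun k => (k : ℝ)),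
        mallowsExp_initialCount_succ hq (i + 1) hj (fun k => (k : ℝ)),
        mallowsExp_initialCount_succ hq i hj (fun k => qNum q (j - k))]
      simp only [Nat.cast_add, Nat.cast_one, mallowsExp_add, mallowsExp_const hq]
      have h1 := ih (i := i) (j := j - 1) (by omega) (by omega)
      have h3 : ∀ π : Equiv.Perm (Fin n),
          j - (initialCount i (j - 1) π + 1) = j - 1 - initialCount i (j - 1) π :=
        fun π => by omega
      simp only [h3, Nat.add_sub_add_right]
      rcases hj.eq_or_lt with hj | hj
      · rw [hj, div_self hpos, ← hj]
        linear_combination h1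
      · have h2 := ih (i := i) (j := j) (by omega) (by omega)
        linear_combination (qNum q j / qNum q (n + 1)) * h1 +
          (1 - qNum q j / qNum q (n + 1)) * h2

lemma mallowsExp_sq_le {q : ℝ} (hq : 0 < q) (n : ℕ) (f : Equiv.Perm (Fin n) → ℝ) :
    mallowsExp n q f ^ 2 ≤ mallowsExp n q (fun π => f π ^ 2) := by
  have h : mallowsExp n q (fun _ => 0) ≤
      mallowsExp n q (fun π => (f π ^ 2 - 2 * mallowsExp n q f * f π) + mallowsExp n q f ^ 2) :=
    mallowsExp_mono hq n fun π => by nlinarith [sq_nonneg (f π - mallowsExp n q f)]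
  rw [mallowsExp_const hq, mallowsExp_add, mallowsExp_sub, mallowsExp_const_mul,
    mallowsExp_const hq] at h
  nlinarith

/-- The `q`-count of initial points sent to initial points has variance at most its mean. -/
lemma mallowsExp_sq_sub_mean_le {q : ℝ} (hq : 0 < q) {n i j : ℕ} (hi : i ≤ n) (hj : j ≤ n) :
    mallowsExp n q (fun π =>
      (qNum q (initialCount i j π) - qNum q i * qNum q j / qNum q n) ^ 2) ≤ qNum q n := by
  rcases Nat.eq_zero_or_pos i with rfl | hi0
  · simp [initialCount_zero, qNum_zero, mallowsExp, qNum_nonneg hq]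
  rcases Nat.eq_zero_or_pos j with rfl | hj0
  · have h0 : ∀ π : Equiv.Perm (Fin n), initialCount i 0 π = 0 :=
      fun π => Nat.le_zero.1 (initialCount_le i 0 π)
    simp [h0, qNum_zero, mallowsExp, qNum_nonneg hq]
  set μ := qNum q i * qNum q j / qNum q n with hμ
  have e : ∀ π : Equiv.Perm (Fin n), (qNum q (initialCount i j π) - μ) ^ 2 =
      qNum q (initialCount i j π) * (qNum q (initialCount i j π) - 1) +
        ((1 - 2 * μ) * qNum q (initialCount i j π) + μ ^ 2) := fun π => by ring
  simp only [e]
  rw [mallowsExp_add, mallowsExp_add, mallowsExp_const_mul, mallowsExp_const hq,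
    mallowsExp_qNum_mul_qNum_initialCount hq hi hj, mallowsExp_qNum_initialCount hq hi hj, ← hμ]
  have hn : 0 < qNum q n := qNum_pos hq (by omega)
  have hi1 : 1 ≤ qNum q i := by simpa [qNum_one] using qNum_mono hq (show 1 ≤ i from hi0)
  have hj1 : 1 ≤ qNum q j := by simpa [qNum_one] using qNum_mono hq (show 1 ≤ j from hj0)
  have hin := qNum_mono hq hi
  have hjn := qNum_mono hq hj
  have hμn : μ ≤ qNum q n := by
    rw [hμ, div_le_iff₀ hn]
    exact mul_le_mul hin hjn (by linarith) hn.le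
  have key : ∀ x, 1 ≤ x → x ≤ qNum q n → (x - 1) / (qNum q n - 1) ≤ x / qNum q n := by
    intro x hx hxn
    rcases eq_or_lt_of_le (hx.trans hxn) with h1 | h1
    · rw [← h1]; simp; linarith
    · rw [div_le_div_iff₀ (by linarith) hn]
      nlinarith
  have h2 : qNum q i * (qNum q i - 1) * (qNum q j * (qNum q j - 1)) /
      (qNum q n * (qNum q n - 1)) ≤ μ ^ 2 := by
    have e1 : qNum q i * (qNum q i - 1) * (qNum q j * (qNum q j - 1)) /
      (qNum q n * (qNum q n - 1)) = μ * (qNum q j - 1) * ((qNum q i - 1) / (qNum q n - 1)) := by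
      rw [hμ, mul_div_assoc', div_mul_eq_mul_div, div_mul_eq_mul_div, div_div]
      ring
    have e2 : μ ^ 2 = μ * qNum q j * (qNum q i / qNum q n) := by rw [hμ]; ring
    have hμ0 : 0 ≤ μ := by positivity
    rw [e1, e2]
    have hq0 : (0 : ℝ) ≤ qNum q j := by linarith
    have hk : 0 ≤ (qNum q i - 1) / (qNum q n - 1) := div_nonneg (by linarith) (by linarith)
    refine mul_le_mul (mul_le_mul_of_nonneg_left (by linarith) hμ0) (key _ hi1 hin) hk ?_
    positivity
  nlinarith

/-- The probability, under the Mallows measure, that the point with zero-based index `i` is sent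
to one of the first `j` points. -/
noncomputable def mallowsCdf (n : ℕ) (q : ℝ) (i j : ℕ) : ℝ :=
  mallowsExp n q (fun π => (initialCount (i + 1) j π : ℝ) - initialCount i j π)

lemma initialCount_succ_sub {n : ℕ} (i : Fin n) (j : ℕ) (π : Equiv.Perm (Fin n)) :
    (initialCount ((i : ℕ) + 1) j π : ℝ) - initialCount (i : ℕ) j π =
      if (π i : ℕ) < j then 1 else 0 := by
  simp only [initialCount, Nat.cast_sum, ← Finset.sum_sub_distrib]
  rw [Finset.sum_eq_single i]
  · simp
  · intro k _ hk
    have : (k : ℕ) ≠ i := fun h => hk (Fin.ext h)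
    have : (k : ℕ) < i + 1 ↔ (k : ℕ) < i := by omega
    simp [this]
  · simp

lemma mallowsCdf_eq (n : ℕ) (q : ℝ) (i : Fin n) (j : ℕ) :
    mallowsCdf n q i j = mallowsExp n q (fun π => if (π i : ℕ) < j then 1 else 0) := by
  simp only [mallowsCdf, initialCount_succ_sub]

lemma mallowsProb_eq_mallowsCdf_sub (n : ℕ) (q : ℝ) (i : Fin n) {j₁ j₂ : ℕ} (h : j₁ ≤ j₂) :
    mallowsProb n q (fun π => j₁ ≤ (π i : ℕ) ∧ (π i : ℕ) < j₂) =
      mallowsCdf n q i j₂ - mallowsCdf n q i j₁ := by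
  rw [mallowsCdf_eq, mallowsCdf_eq, ← mallowsExp_sub, mallowsProb, mallowsExp]
  refine Finset.sum_congr rfl fun π _ => ?_
  by_cases h1 : (π i : ℕ) < j₁
  · have h2 : (π i : ℕ) < j₂ := by omega
    simp [h1, h2]
  · by_cases h2 : (π i : ℕ) < j₂
    · simp [h1, h2, not_lt.1 h1]
    · simp [h1, h2]

lemma inversions_permCongr_rev (n : ℕ) (π : Equiv.Perm (Fin n)) :
    inversions n (Fin.revPerm.permCongr π) = inversions n π := by
  refine Finset.card_bij (fun p _ => (p.2.rev, p.1.rev)) ?_ ?_ ?_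
  · rintro ⟨x, y⟩ h
    simpa [Equiv.permCongr_apply, Fin.rev_lt_rev] using h
  · rintro ⟨x, y⟩ _ ⟨x', y'⟩ _ h
    simp only [Prod.mk.injEq, Fin.rev_inj] at h
    exact Prod.ext h.2 h.1
  · rintro ⟨x, y⟩ h
    refine ⟨(y.rev, x.rev), ?_, by simp⟩
    simpa [Equiv.permCongr_apply, Fin.rev_lt_rev] using h

/-- Reversing positions and values preserves the Mallows measure. -/
lemma mallowsCdf_rev {n : ℕ} {q : ℝ} (hq : 0 < q) {i j : ℕ} (hi : i < n) (hj : j ≤ n) :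
    mallowsCdf n q i j = 1 - mallowsCdf n q (n - (i + 1)) (n - j) := by
  have e : n - (i + 1) = ((Fin.rev ⟨i, hi⟩ : Fin n) : ℕ) := by simp [Fin.val_rev]
  rw [e]
  have e' : mallowsCdf n q i j = mallowsCdf n q ((⟨i, hi⟩ : Fin n) : ℕ) j := rfl
  rw [e', mallowsCdf_eq, mallowsCdf_eq]
  conv_rhs => lhs; rw [← mallowsExp_const hq n 1]
  rw [← mallowsExp_sub]
  simp only [mallowsExp]
  rw [← (Equiv.permCongr (Fin.revPerm (n := n))).sum_comp]
  refine Finset.sum_congr rfl fun π _ => ?_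
  have h1 : mallowsPMF n q (Fin.revPerm.permCongr π) = mallowsPMF n q π := by
    rw [mallowsPMF, inversions_permCongr_rev, mallowsPMF]
  rw [h1]
  congr 1
  simp only [Equiv.permCongr_apply, Fin.revPerm_symm, Fin.revPerm_apply, Fin.val_rev]
  have := (π (Fin.rev ⟨i, hi⟩)).isLt
  by_cases h : ((π (Fin.rev ⟨i, hi⟩) : Fin n) : ℕ) < n - j
  · have h' : ¬ (n - ((π (Fin.rev ⟨i, hi⟩) : ℕ) + 1) < j) := by omega
    simp [h, h']
  · have h' : n - ((π (Fin.rev ⟨i, hi⟩) : ℕ) + 1) < j := by omega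
    simp [h, h']

lemma qNum_sub_mul_pos {q : ℝ} (hq : 0 < q) {n i j : ℕ} (hn : 0 < n) (hi : i ≤ n) :
    0 < qNum q n - (1 - q) * (qNum q i * qNum q j) := by
  have h1 := qNum_pos hq hn
  have h2 := qNum_nonneg hq i
  have h3 := qNum_nonneg hq j
  have h4 := qNum_mono hq hi
  rcases le_total q 1 with h | h
  · have h5 := pow_eq_one_sub_mul_qNum q j
    have h6 : 0 < q ^ j := by positivity
    have h7 : (1 - q) * qNum q j * qNum q i ≤ (1 - q) * qNum q j * qNum q n :=
      mul_le_mul_of_nonneg_left h4 (mul_nonneg (by linarith) h3)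
    nlinarith [mul_pos h1 h6]
  · nlinarith [mul_nonneg h2 h3]

/-- A quantitative law of large numbers for the distribution function of `π i`. -/
lemma sq_mallowsCdf_sub_le {q : ℝ} (hq : 0 < q) {n i j : ℕ} (hi : i < n) (hj : j ≤ n) :
    (mallowsCdf n q i j -
      qNum q j * q ^ i / (qNum q n - (1 - q) * (qNum q i * qNum q j))) ^ 2 ≤
      (max 1 (q ^ n) * qNum q n / (qNum q n - (1 - q) * (qNum q i * qNum q j))) ^ 2 *
        qNum q n / qNum q (n - i) ^ 2 := by
  have hn : 0 < qNum q n := qNum_pos hq (by omega)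
  have hni : 0 < qNum q (n - i) := qNum_pos hq (by omega)
  have hden := qNum_sub_mul_pos hq (n := n) (i := i) (j := j) (by omega) hi.le
  set D := qNum q n - (1 - q) * (qNum q i * qNum q j) with hD
  set μ := qNum q i * qNum q j / qNum q n with hμ
  have hsplit : qNum q n = qNum q i + q ^ i * qNum q (n - i) := by
    rw [← qNum_add, Nat.add_sub_cancel' hi.le]
  have e1 : mallowsCdf n q i j - qNum q j * q ^ i / D =
      mallowsExp n q (fun π => qNum q (j - initialCount i j π) -
        qNum q j * q ^ i * qNum q (n - i) / D) / qNum q (n - i) := by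
    rw [mallowsExp_sub, mallowsExp_const hq, mallowsCdf, mallowsExp_sub,
      mallowsExp_initialCount_sub hq hi hj]
    field_simp
  have e2 : ∀ π : Equiv.Perm (Fin n), qNum q (j - initialCount i j π) -
        qNum q j * q ^ i * qNum q (n - i) / D =
      q ^ (j - initialCount i j π) * qNum q n / D * (μ - qNum q (initialCount i j π)) := by
    intro π
    have hk := initialCount_le i j π
    generalize initialCount i j π = k at hk
    have h1 : qNum q j = qNum q (j - k) + q ^ (j - k) * qNum q k := by
      rw [← qNum_add, Nat.sub_add_cancel hk]
    have h2 := pow_eq_one_sub_mul_qNum q (j - k)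
    have h3 : q ^ i * qNum q (n - i) = qNum q n - qNum q i := by linarith
    rw [mul_assoc, h3, hμ]
    field_simp
    rw [hD]
    linear_combination (-qNum q n) * h1 - qNum q i * qNum q j * h2
  have e3 : ∀ π : Equiv.Perm (Fin n), (qNum q (j - initialCount i j π) -
        qNum q j * q ^ i * qNum q (n - i) / D) ^ 2 ≤
      (max 1 (q ^ n) * qNum q n / D) ^ 2 * (qNum q (initialCount i j π) - μ) ^ 2 := by
    intro π
    rw [e2, mul_pow, ← neg_sub μ, neg_sq]
    refine mul_le_mul_of_nonneg_right ?_ (sq_nonneg _)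
    have : q ^ (j - initialCount i j π) ≤ max 1 (q ^ n) := by
      rcases le_total q 1 with h | h
      · exact (pow_le_one₀ hq.le h).trans (le_max_left _ _)
      · exact (pow_le_pow_right₀ h (by omega)).trans (le_max_right _ _)
    gcongr
  rw [e1, div_pow]
  gcongr
  refine (mallowsExp_sq_le hq n _).trans ((mallowsExp_mono hq n e3).trans ?_)
  rw [mallowsExp_const_mul]
  exact mul_le_mul_of_nonneg_left (mallowsExp_sq_sub_mean_le hq hi.le hj) (sq_nonneg _)

/-- The integral of `t ↦ exp (-β t)` over `[0, x]`. -/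
noncomputable def expInt (β x : ℝ) : ℝ := if β = 0 then x else (1 - Real.exp (-β * x)) / β

lemma exp_eq_one_sub_mul_expInt (β x : ℝ) : Real.exp (-β * x) = 1 - β * expInt β x := by
  by_cases h : β = 0
  · simp [h]
  · rw [expInt, if_neg h, mul_div_cancel₀ _ h]
    ring

lemma expInt_strictMono (β : ℝ) : StrictMono (expInt β) := by
  intro x y hxy
  rcases lt_trichotomy β 0 with h | h | h
  · rw [expInt, expInt, if_neg h.ne, if_neg h.ne, div_lt_div_right_of_neg h]
    have : Real.exp (-β * x) < Real.exp (-β * y) := Real.exp_lt_exp.2 (by nlinarith)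
    linarith
  · simpa [expInt, h] using hxy
  · rw [expInt, expInt, if_neg h.ne', if_neg h.ne', div_lt_div_iff_of_pos_right h]
    have : Real.exp (-β * y) < Real.exp (-β * x) := Real.exp_lt_exp.2 (by nlinarith)
    linarith

lemma expInt_zero (β : ℝ) : expInt β 0 = 0 := by simp [expInt]

lemma expInt_pos (β : ℝ) {x : ℝ} (hx : 0 < x) : 0 < expInt β x := by
  simpa [expInt_zero] using expInt_strictMono β hx

lemma hasDerivAt_expInt (β x : ℝ) : HasDerivAt (expInt β) (Real.exp (-β * x)) x := by
  by_cases h : β = 0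
  · have : expInt β = id := by ext; simp [expInt, h]
    rw [this, h]
    simpa using hasDerivAt_id x
  · have h1 : expInt β = fun y => (1 - Real.exp (-β * y)) / β := by ext; simp [expInt, h]
    have h2 := ((((hasDerivAt_id x).const_mul (-β)).exp).const_sub 1).div_const β
    rw [h1]
    refine h2.congr_deriv ?_
    simp only [id]
    field_simp

/-- The denominator of the limiting distribution function. -/
noncomputable def limitDenom (β x y : ℝ) : ℝ := expInt β 1 - β * (expInt β x * expInt β y)

/-- The limiting distribution function of `π i / n`, where `i / n → x`. -/
noncomputable def limitCdf (β x y : ℝ) : ℝ :=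
  expInt β y * Real.exp (-β * x) / limitDenom β x y

lemma limitDenom_pos {β x y : ℝ} (hx0 : 0 ≤ x) (hx : x ≤ 1) (hy : 0 ≤ y) :
    0 < limitDenom β x y := by
  rw [limitDenom]
  have h1 := expInt_pos β one_pos
  have hm := (expInt_strictMono β).monotone
  have h2 := hm hx0
  have h3 := hm hy
  have h4 := hm hx
  rw [expInt_zero] at h2 h3
  rcases le_total β 0 with h | h
  · nlinarith [mul_nonneg h2 h3]
  · have h5 := exp_eq_one_sub_mul_expInt β y
    have h6 := Real.exp_pos (-β * y)
    have h7 : β * expInt β y * expInt β x ≤ β * expInt β y * expInt β 1 :=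
      mul_le_mul_of_nonneg_left h4 (mul_nonneg h h3)
    nlinarith [mul_pos h1 h6]

lemma mallowsU_eq {β x y : ℝ} (hx0 : 0 ≤ x) (hx : x ≤ 1) (hy : 0 ≤ y) :
    mallowsU x y β =
      Real.exp (-β * x) * Real.exp (-β * y) * expInt β 1 / limitDenom β x y ^ 2 := by
  have hD := (limitDenom_pos (β := β) hx0 hx hy).ne'
  by_cases h : β = 0
  · simp [mallowsU, limitDenom, expInt, h]
  rw [mallowsU, if_neg h]
  have key : (Real.exp (β / 4) * Real.cosh (β * (x - y) / 2)
      - Real.exp (-β / 4) * Real.cosh (β * (x + y - 1) / 2)) =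
      Real.exp (β / 4) * Real.exp (β * x / 2) * Real.exp (β * y / 2) / 2 *
        (β * limitDenom β x y) := by
    have e1 : β * limitDenom β x y = Real.exp (-β * x) + Real.exp (-β * y)
        - Real.exp (-β * x) * Real.exp (-β * y) - Real.exp (-β * 1) := by
      rw [limitDenom]
      simp only [exp_eq_one_sub_mul_expInt β]
      ring
    rw [e1]
    simp only [Real.cosh_eq, mul_sub, mul_add, mul_div_assoc', div_mul_eq_mul_div, ← Real.exp_add,
      ← sub_div, ← add_div]
    rw [div_left_inj' two_ne_zero]
    ring_nf
  have key2 : Real.sinh (β / 2) = Real.exp (β / 2) / 2 * (β * expInt β 1) := by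
    have e1 : β * expInt β 1 = 1 - Real.exp (-β * 1) := by
      rw [exp_eq_one_sub_mul_expInt]
      ring
    rw [e1, Real.sinh_eq, div_mul_eq_mul_div, mul_sub, ← Real.exp_add]
    ring_nf
  have e2 : Real.exp (β / 2) = Real.exp (β / 4) ^ 2 := by rw [← Real.exp_nat_mul]; ring_nf
  have e3 : ∀ z, Real.exp (-β * z) = (Real.exp (β * z / 2) ^ 2)⁻¹ := by
    intro z
    rw [← Real.exp_nat_mul, ← Real.exp_neg]
    ring_nf
  rw [key, key2, e2, e3, e3]
  field_simp

lemma mallowsU_pos {β x y : ℝ} (hx0 : 0 ≤ x) (hx : x ≤ 1) (hy : 0 ≤ y) : 0 < mallowsU x y β := by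
  rw [mallowsU_eq hx0 hx hy]
  have := limitDenom_pos (β := β) hx0 hx hy
  have := expInt_pos β one_pos
  positivity

lemma hasDerivAt_limitCdf {β x y : ℝ} (hx0 : 0 ≤ x) (hx : x ≤ 1) (hy : 0 ≤ y) :
    HasDerivAt (limitCdf β x) (mallowsU x y β) y := by
  have hD := (limitDenom_pos (β := β) hx0 hx hy).ne'
  have h1 := hasDerivAt_expInt β y
  have h2 : HasDerivAt (limitDenom β x) (-(β * (expInt β x * Real.exp (-β * y)))) y :=
    ((h1.const_mul (expInt β x)).const_mul β).const_sub (expInt β 1)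
  have h3 := (h1.mul_const (Real.exp (-β * x))).div h2 hD
  rw [mallowsU_eq hx0 hx hy]
  refine h3.congr_deriv ?_
  congr 1
  simp only [limitDenom]
  ring

lemma limitCdf_rev {β x y : ℝ} (hx0 : 0 ≤ x) (hx : x ≤ 1) (hy0 : 0 ≤ y) (hy : y ≤ 1) :
    limitCdf β x y = 1 - limitCdf β (1 - x) (1 - y) := by
  have hD := (limitDenom_pos (β := β) hx0 hx hy0).ne'
  have hD' := (limitDenom_pos (β := β) (sub_nonneg.2 hx) (by linarith) (sub_nonneg.2 hy)).ne'
  rw [limitCdf, limitCdf, eq_sub_iff_add_eq, div_add_div _ _ hD hD', div_eq_one_iff_eq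
    (mul_ne_zero hD hD')]
  by_cases h : β = 0
  · simp [limitDenom, expInt, h]
  simp only [limitDenom, expInt, if_neg h]
  have e : ∀ z, Real.exp (-β * (1 - z)) = Real.exp (-β * 1) / Real.exp (-β * z) := by
    intro z
    rw [← Real.exp_sub]
    ring_nf
  rw [e, e]
  have := Real.exp_ne_zero (-β * x)
  have := Real.exp_ne_zero (-β * y)
  generalize Real.exp (-β * x) = X at *
  generalize Real.exp (-β * y) = Y at *
  field_simp
  ring

section limits

variable {q : ℕ → ℝ} {β : ℝ}

lemma tendsto_pow_exp (hq : ∀ n, 0 < q n)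
    (hβ : Tendsto (fun n : ℕ => (n : ℝ) * (1 - q n)) atTop (nhds β))
    {k : ℕ → ℕ} {y : ℝ} (hk : Tendsto (fun n : ℕ => (k n : ℝ) / n) atTop (nhds y)) :
    Tendsto (fun n => q n ^ k n) atTop (nhds (Real.exp (-β * y))) := by
  have h1 : Tendsto (fun n : ℕ => (1 + (q n - 1)) ^ n) atTop (nhds (Real.exp (-β))) := by
    refine Real.tendsto_one_add_pow_exp_of_tendsto (hβ.neg.congr fun n => ?_)
    ring
  have h2 := h1.rpow hk (Or.inl (Real.exp_ne_zero _))
  rw [← Real.exp_mul] at h2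
  refine h2.congr' ?_
  filter_upwards [eventually_gt_atTop 0] with n hn
  have hn' : (n : ℝ) ≠ 0 := by positivity
  rw [add_sub_cancel, ← Real.rpow_natCast (q n) n, ← Real.rpow_mul (hq n).le, mul_div_cancel₀ _ hn',
    Real.rpow_natCast]

lemma tendsto_nat_div_self : Tendsto (fun n : ℕ => (n : ℝ) / n) atTop (nhds 1) := by
  refine tendsto_const_nhds.congr' ?_
  filter_upwards [eventually_gt_atTop 0] with n hn
  rw [div_self (by positivity)]

lemma tendsto_max_one_pow (hq : ∀ n, 0 < q n)
    (hβ : Tendsto (fun n : ℕ => (n : ℝ) * (1 - q n)) atTop (nhds β)) :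
    Tendsto (fun n => max 1 (q n ^ n)) atTop (nhds (max 1 (Real.exp (-β)))) := by
  have := tendsto_pow_exp hq hβ tendsto_nat_div_self
  rw [mul_one] at this
  exact tendsto_const_nhds.max this

lemma tendsto_qNum_div (hq : ∀ n, 0 < q n)
    (hβ : Tendsto (fun n : ℕ => (n : ℝ) * (1 - q n)) atTop (nhds β))
    {k : ℕ → ℕ} {y : ℝ} (hkn : ∀ᶠ n in atTop, k n ≤ n)
    (hk : Tendsto (fun n : ℕ => (k n : ℝ) / n) atTop (nhds y)) :
    Tendsto (fun n => qNum (q n) (k n) / n) atTop (nhds (expInt β y)) := by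
  by_cases h : β = 0
  · subst h
    have e : expInt 0 y = y := by simp [expInt]
    rw [e]
    have hmax := hk.mul (tendsto_max_one_pow hq hβ)
    have hmin := hk.mul ((tendsto_const_nhds (x := (1 : ℝ))).min
      (tendsto_pow_exp hq hβ tendsto_nat_div_self))
    simp only [neg_zero, Real.exp_zero, max_self, min_self, mul_one] at hmax hmin
    refine tendsto_of_tendsto_of_tendsto_of_le_of_le' hmin hmax ?_ ?_
    · filter_upwards [hkn] with n hn
      rw [div_mul_eq_mul_div]
      refine div_le_div_of_nonneg_right ?_ n.cast_nonneg
      rw [← nsmul_eq_mul]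
      nth_rw 1 [← Finset.card_range (k n)]
      refine Finset.card_nsmul_le_sum _ _ _ fun l hl => ?_
      rw [Finset.mem_range] at hl
      rcases le_total (q n) 1 with h | h
      · exact (min_le_right _ _).trans (pow_le_pow_of_le_one (hq n).le h (by omega))
      · exact (min_le_left _ _).trans (one_le_pow₀ h)
    · filter_upwards [hkn] with n hn
      rw [div_mul_eq_mul_div]
      refine div_le_div_of_nonneg_right ?_ n.cast_nonneg
      rw [← nsmul_eq_mul]
      nth_rw 2 [← Finset.card_range (k n)]
      refine Finset.sum_le_card_nsmul _ _ _ fun l hl => ?_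
      rw [Finset.mem_range] at hl
      rcases le_total (q n) 1 with h | h
      · exact (pow_le_one₀ (hq n).le h).trans (le_max_left _ _)
      · exact (pow_le_pow_right₀ h (by omega)).trans (le_max_right _ _)
  · rw [expInt, if_neg h]
    refine (((tendsto_pow_exp hq hβ hk).const_sub 1).div hβ h).congr' ?_
    filter_upwards [hβ.eventually_ne h, eventually_gt_atTop 0] with n hn hn0
    have h1 : 1 - q n ≠ 0 := fun h => hn (by simp [h])
    have h2 : (n : ℝ) ≠ 0 := by positivity
    simp only [Pi.div_apply]
    rw [pow_eq_one_sub_mul_qNum]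
    field_simp
    ring

lemma tendsto_mallowsCdf_of_lt_one (hq : ∀ n, 0 < q n)
    (hβ : Tendsto (fun n : ℕ => (n : ℝ) * (1 - q n)) atTop (nhds β))
    {i j : ℕ → ℕ} {x y : ℝ} (hin : ∀ᶠ n in atTop, i n < n) (hjn : ∀ᶠ n in atTop, j n ≤ n)
    (hi : Tendsto (fun n : ℕ => (i n : ℝ) / n) atTop (nhds x))
    (hj : Tendsto (fun n : ℕ => (j n : ℝ) / n) atTop (nhds y))
    (hx0 : 0 ≤ x) (hx : x < 1) (hy : 0 ≤ y) :
    Tendsto (fun n => mallowsCdf n (q n) (i n) (j n)) atTop (nhds (limitCdf β x y)) := by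
  have hD := (limitDenom_pos (β := β) hx0 hx.le hy).ne'
  have hin' : ∀ᶠ n in atTop, i n ≤ n := hin.mono fun n h => h.le
  have ti := tendsto_qNum_div hq hβ hin' hi
  have tj := tendsto_qNum_div hq hβ hjn hj
  have tn := tendsto_qNum_div hq hβ (Eventually.of_forall fun n => le_refl n) tendsto_nat_div_self
  have hni : Tendsto (fun n : ℕ => ((n - i n : ℕ) : ℝ) / n) atTop (nhds (1 - x)) := by
    refine (tendsto_nat_div_self.sub hi).congr' ?_
    filter_upwards [hin'] with n hn
    rw [Nat.cast_sub hn, sub_div]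
  have tni := tendsto_qNum_div hq hβ (Eventually.of_forall fun n => Nat.sub_le n (i n)) hni
  have tD : Tendsto (fun n => (qNum (q n) n - (1 - q n) * (qNum (q n) (i n) * qNum (q n) (j n))) / n)
      atTop (nhds (limitDenom β x y)) := by
    refine (tn.sub (hβ.mul (ti.mul tj))).congr' ?_
    filter_upwards [eventually_gt_atTop 0] with n hn
    field_simp
  have tmain : Tendsto (fun n => qNum (q n) (j n) * q n ^ i n /
      (qNum (q n) n - (1 - q n) * (qNum (q n) (i n) * qNum (q n) (j n)))) atTop
      (nhds (limitCdf β x y)) := by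
    refine ((tj.mul (tendsto_pow_exp hq hβ hi)).div tD hD).congr' ?_
    filter_upwards [eventually_gt_atTop 0] with n hn
    have hn' : (n : ℝ) ≠ 0 := by positivity
    simp only [Pi.div_apply]
    rw [div_mul_eq_mul_div, div_div_div_cancel_right₀ hn']
  have hx1 : expInt β (1 - x) ^ 2 ≠ 0 := pow_ne_zero _ (expInt_pos β (sub_pos.2 hx)).ne'
  have terr := (((((tendsto_max_one_pow hq hβ).mul tn).div tD hD).pow 2).mul tn).div
    (tni.pow 2) hx1 |>.mul (tendsto_one_div_atTop_nhds_zero_nat (𝕜 := ℝ))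
  rw [mul_zero] at terr
  have tsq : Tendsto (fun n => (mallowsCdf n (q n) (i n) (j n) - qNum (q n) (j n) * q n ^ i n /
      (qNum (q n) n - (1 - q n) * (qNum (q n) (i n) * qNum (q n) (j n)))) ^ 2) atTop (nhds 0) := by
    refine squeeze_zero' (Eventually.of_forall fun n => sq_nonneg _) ?_ terr
    filter_upwards [hin, hjn] with n h1 h2
    refine (sq_mallowsCdf_sub_le (hq n) h1 h2).trans (le_of_eq ?_)
    have hn' : (n : ℝ) ≠ 0 := by
      have : 0 < n := by omega
      positivity
    have := (qNum_sub_mul_pos (hq n) (j := j n) (by omega) h1.le).ne'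
    have := (qNum_pos (hq n) (k := n - i n) (by omega)).ne'
    simp only [Pi.div_apply]
    field_simp
  have tdiff : Tendsto (fun n => mallowsCdf n (q n) (i n) (j n) - qNum (q n) (j n) * q n ^ i n /
      (qNum (q n) n - (1 - q n) * (qNum (q n) (i n) * qNum (q n) (j n)))) atTop (nhds 0) := by
    rw [tendsto_zero_iff_abs_tendsto_zero]
    have := tsq.sqrt
    rw [Real.sqrt_zero] at this
    exact this.congr fun n => Real.sqrt_sq_eq_abs _
  simpa using tdiff.add tmain

lemma tendsto_mallowsCdf (hq : ∀ n, 0 < q n)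
    (hβ : Tendsto (fun n : ℕ => (n : ℝ) * (1 - q n)) atTop (nhds β))
    {i j : ℕ → ℕ} {x y : ℝ} (hin : ∀ᶠ n in atTop, i n < n) (hjn : ∀ᶠ n in atTop, j n ≤ n)
    (hi : Tendsto (fun n : ℕ => (i n : ℝ) / n) atTop (nhds x))
    (hj : Tendsto (fun n : ℕ => (j n : ℝ) / n) atTop (nhds y))
    (hx0 : 0 ≤ x) (hx : x ≤ 1) (hy0 : 0 ≤ y) (hy : y ≤ 1) :
    Tendsto (fun n => mallowsCdf n (q n) (i n) (j n)) atTop (nhds (limitCdf β x y)) := by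
  rcases hx.lt_or_eq with hx1 | rfl
  · exact tendsto_mallowsCdf_of_lt_one hq hβ hin hjn hi hj hx0 hx1 hy0
  rw [limitCdf_rev hx0 hx hy0 hy]
  have hj' : Tendsto (fun n : ℕ => ((n - j n : ℕ) : ℝ) / n) atTop (nhds (1 - y)) := by
    refine (tendsto_nat_div_self.sub hj).congr' ?_
    filter_upwards [hjn] with n hn
    rw [Nat.cast_sub hn, sub_div]
  have hi' : Tendsto (fun n : ℕ => ((n - (i n + 1) : ℕ) : ℝ) / n) atTop (nhds (1 - 1)) := by
    have := (tendsto_nat_div_self.sub hi).sub (tendsto_one_div_atTop_nhds_zero_nat (𝕜 := ℝ))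
    rw [sub_zero] at this
    refine this.congr' ?_
    filter_upwards [hin] with n hn
    rw [Nat.cast_sub hn, ← sub_div, ← sub_div]
    push_cast
    ring
  have := tendsto_mallowsCdf_of_lt_one hq hβ (i := fun n => n - (i n + 1)) (j := fun n => n - j n)
    (hin.mono fun n hn => by omega) (Eventually.of_forall fun n => Nat.sub_le _ _) hi' hj'
    (by norm_num) (by norm_num) (sub_nonneg.2 hy)
  refine (this.const_sub 1).congr' ?_
  filter_upwards [hin, hjn] with n h1 h2
  exact (mallowsCdf_rev (hq n) h1 h2).symm

lemma tendsto_mallowsProb_Ioo (hq : ∀ n, 0 < q n)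
    (hβ : Tendsto (fun n : ℕ => (n : ℝ) * (1 - q n)) atTop (nhds β))
    {a : ℕ → ℕ} (ha : ∀ n : ℕ, 1 ≤ n → 1 ≤ a n ∧ a n ≤ n)
    {x : ℝ} (hax : Tendsto (fun n : ℕ => (a n : ℝ) / n) atTop (nhds x))
    (hx0 : 0 ≤ x) (hx : x ≤ 1) {c d : ℝ} (hc : 0 ≤ c) (hcd : c < d) (hd : d ≤ 1) :
    Tendsto (fun n : ℕ => mallowsProb n (q n)
        (fun π => (permAct n π (a n) : ℝ) / n ∈ Set.Ioo c d)) atTop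
      (nhds (limitCdf β x d - limitCdf β x c)) := by
  have hinv := tendsto_one_div_atTop_nhds_zero_nat (𝕜 := ℝ)
  have hi : Tendsto (fun n : ℕ => ((a n - 1 : ℕ) : ℝ) / n) atTop (nhds x) := by
    have := hax.sub hinv
    rw [sub_zero] at this
    refine this.congr' ?_
    filter_upwards [eventually_ge_atTop 1] with n hn
    rw [Nat.cast_sub (ha n hn).1, ← sub_div, Nat.cast_one]
  have hin : ∀ᶠ n in atTop, a n - 1 < n := by
    filter_upwards [eventually_ge_atTop 1] with n hn
    have := ha n hn
    omega
  have hfl : Tendsto (fun n : ℕ => (⌊c * n⌋₊ : ℝ) / n) atTop (nhds c) :=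
    (tendsto_nat_floor_mul_div_atTop hc).comp tendsto_natCast_atTop_atTop
  have hcl : Tendsto (fun n : ℕ => ((⌈d * n⌉₊ - 1 : ℕ) : ℝ) / n) atTop (nhds d) := by
    have h1 : Tendsto (fun n : ℕ => (⌈d * n⌉₊ : ℝ) / n) atTop (nhds d) :=
      (tendsto_nat_ceil_mul_div_atTop (by linarith)).comp tendsto_natCast_atTop_atTop
    have := h1.sub hinv
    rw [sub_zero] at this
    refine this.congr' ?_
    filter_upwards [eventually_ge_atTop 1] with n hn
    have h0 : 0 < ⌈d * n⌉₊ := Nat.ceil_pos.2 (mul_pos (by linarith) (by exact_mod_cast hn))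
    rw [Nat.cast_sub h0, ← sub_div, Nat.cast_one]
  have hfn : ∀ n : ℕ, ⌊c * n⌋₊ ≤ n := fun n =>
    Nat.floor_le_of_le (by nlinarith [n.cast_nonneg (α := ℝ)])
  have hcn : ∀ n : ℕ, ⌈d * n⌉₊ ≤ n := fun n =>
    Nat.ceil_le.2 (by nlinarith [n.cast_nonneg (α := ℝ)])
  have t1 := tendsto_mallowsCdf hq hβ hin (Eventually.of_forall hfn) hi hfl hx0 hx hc
    (hcd.le.trans hd)
  have t2 := tendsto_mallowsCdf hq hβ hin
    (Eventually.of_forall fun n => (Nat.sub_le _ 1).trans (hcn n)) hi hcl hx0 hx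
    (hc.trans hcd.le) hd
  refine (t2.sub t1).congr' ?_
  filter_upwards [eventually_ge_atTop 1] with n hn
  have hn0 : (0 : ℝ) < n := by exact_mod_cast hn
  have han := ha n hn
  have hfc : ⌊c * n⌋₊ < ⌈d * n⌉₊ := by
    rw [Nat.lt_ceil]
    exact (Nat.floor_le (by positivity)).trans_lt (by gcongr)
  have := mallowsProb_eq_mallowsCdf_sub n (q n) ⟨a n - 1, by omega⟩
    (show ⌊c * n⌋₊ ≤ ⌈d * n⌉₊ - 1 by omega)
  simp only at this
  rw [← this]
  congr 1
  ext π
  rw [permAct, dif_pos han, Set.mem_Ioo, lt_div_iff₀ hn0, div_lt_iff₀ hn0, ← Nat.lt_ceil,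
    ← Nat.floor_lt (by positivity)]
  omega

end limits

lemma tendsto_limsup_ratio_sub {l : Filter ℝ} {f g : ℝ → ℕ → ℝ} {F G s : ℝ → ℝ}
    {u v : ℝ}
    (hs : ∀ᶠ ε in l, s ε ≠ 0)
    (hf : ∀ᶠ ε in l, Tendsto (f ε) atTop (nhds (F ε)))
    (hg : ∀ᶠ ε in l, Tendsto (g ε) atTop (nhds (G ε)))
    (hF : Tendsto (fun ε => F ε / s ε) l (nhds u)) (hG : Tendsto (fun ε => G ε / s ε) l (nhds v))
    (hv : v ≠ 0) :
    Tendsto (fun ε => limsup (fun n => |f ε n / g ε n - u / v|) atTop) l (nhds 0) := by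
  have h1 : Tendsto (fun ε => |F ε / G ε - u / v|) l (nhds 0) := by
    have h2 : Tendsto (fun ε => F ε / G ε) l (nhds (u / v)) := by
      refine (hF.div hG hv).congr' ?_
      filter_upwards [hs] with ε hε
      exact div_div_div_cancel_right₀ hε _ _
    have := (h2.sub_const (u / v)).abs
    rwa [sub_self, abs_zero] at this
  refine h1.congr' ?_
  filter_upwards [hf, hg, hG.eventually_ne hv] with ε h2 h3 h4
  have h5 : G ε ≠ 0 := fun h => h4 (by simp [h])
  exact ((h2.div h3 h5).sub_const (u / v)).abs.limsup_eq.symm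

/-- **Lemma 3.7.** Under `n(1-qₙ) → β` and `aₙ/n → a` with `aₙ ∈ {1,…,n}`:
(i) for `0 ≤ y₁ < y₂ < 1`, the limsup over `n` of
`|μ_{n,qₙ}(π(aₙ)/n ∈ (y₂,y₂+ε)) / μ_{n,qₙ}(π(aₙ)/n ∈ (y₁,y₁+ε)) − u(a,y₂)/u(a,y₁)|`
tends to `0` as `ε → 0⁺`; (ii) similarly for intervals `(y₂−ε,y₂)`, `(y₁−ε,y₁)` when
`0 < y₁ < y₂ ≤ 1`. -/
theorem mallows_local_ratio_limit
    (q : ℕ → ℝ) (hq : ∀ n, 0 < q n) (β : ℝ)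
    (hβ : Tendsto (fun n : ℕ => (n : ℝ) * (1 - q n)) atTop (nhds β))
    (a : ℕ → ℕ) (ha : ∀ n : ℕ, 1 ≤ n → 1 ≤ a n ∧ a n ≤ n)
    (av : ℝ) (haa : Tendsto (fun n : ℕ => (a n : ℝ) / n) atTop (nhds av)) :
    (∀ y₁ y₂ : ℝ, 0 ≤ y₁ → y₁ < y₂ → y₂ < 1 →
      Tendsto (fun ε : ℝ =>
          Filter.limsup (fun n : ℕ =>
            |mallowsProb n (q n)
                (fun π => (permAct n π (a n) : ℝ) / n ∈ Set.Ioo y₂ (y₂ + ε))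
              / mallowsProb n (q n)
                (fun π => (permAct n π (a n) : ℝ) / n ∈ Set.Ioo y₁ (y₁ + ε))
              - mallowsU av y₂ β / mallowsU av y₁ β|) atTop)
        (nhdsWithin 0 (Set.Ioi 0)) (nhds 0)) ∧
    (∀ y₁ y₂ : ℝ, 0 < y₁ → y₁ < y₂ → y₂ ≤ 1 →
      Tendsto (fun ε : ℝ =>
          Filter.limsup (fun n : ℕ =>
            |mallowsProb n (q n)
                (fun π => (permAct n π (a n) : ℝ) / n ∈ Set.Ioo (y₂ - ε) y₂)
              / mallowsProb n (q n)
                (fun π => (permAct n π (a n) : ℝ) / n ∈ Set.Ioo (y₁ - ε) y₁)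
              - mallowsU av y₂ β / mallowsU av y₁ β|) atTop)
        (nhdsWithin 0 (Set.Ioi 0)) (nhds 0)) := by
  have hav0 : 0 ≤ av := ge_of_tendsto' haa fun n => by positivity
  have hav1 : av ≤ 1 := by
    refine le_of_tendsto haa ?_
    filter_upwards [eventually_ge_atTop 1] with n hn
    exact div_le_one_of_le₀ (by exact_mod_cast (ha n hn).2) n.cast_nonneg
  constructor
  · intro y₁ y₂ h0 h12 h1
    have lim : ∀ y, 0 ≤ y → y < 1 → ∀ᶠ ε in nhdsWithin (0 : ℝ) (Set.Ioi 0),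
        Tendsto (fun n : ℕ => mallowsProb n (q n)
          (fun π => (permAct n π (a n) : ℝ) / n ∈ Set.Ioo y (y + ε))) atTop
          (nhds (limitCdf β av (y + ε) - limitCdf β av y)) := by
      intro y hy0 hy1
      filter_upwards [Ioo_mem_nhdsGT (sub_pos.2 hy1)] with ε hε
      exact tendsto_mallowsProb_Ioo hq hβ ha haa hav0 hav1 hy0 (by linarith [hε.1])
        (by linarith [hε.2])
    have slope : ∀ y, 0 ≤ y → Tendsto (fun ε => (limitCdf β av (y + ε) - limitCdf β av y) / ε)
        (nhdsWithin 0 (Set.Ioi 0)) (nhds (mallowsU av y β)) := by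
      intro y hy0
      refine (hasDerivAt_limitCdf hav0 hav1 hy0).tendsto_slope_zero_right.congr fun ε => ?_
      rw [smul_eq_mul, div_eq_inv_mul]
    exact tendsto_limsup_ratio_sub (s := fun ε => ε)
      (eventually_mem_nhdsWithin.mono fun ε hε => ne_of_gt hε)
      (lim y₂ (by linarith) h1) (lim y₁ h0 (by linarith)) (slope y₂ (by linarith)) (slope y₁ h0)
      (mallowsU_pos hav0 hav1 h0).ne'
  · intro y₁ y₂ h0 h12 h1
    have lim : ∀ y, 0 < y → y ≤ 1 → ∀ᶠ ε in nhdsWithin (0 : ℝ) (Set.Ioi 0),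
        Tendsto (fun n : ℕ => mallowsProb n (q n)
          (fun π => (permAct n π (a n) : ℝ) / n ∈ Set.Ioo (y - ε) y)) atTop
          (nhds (limitCdf β av y - limitCdf β av (y - ε))) := by
      intro y hy0 hy1
      filter_upwards [Ioo_mem_nhdsGT hy0] with ε hε
      exact tendsto_mallowsProb_Ioo hq hβ ha haa hav0 hav1 (by linarith [hε.2])
        (by linarith [hε.1]) hy1
    have slope : ∀ y, 0 < y → Tendsto (fun ε => (limitCdf β av y - limitCdf β av (y - ε)) / ε)
        (nhdsWithin 0 (Set.Ioi 0)) (nhds (mallowsU av y β)) := by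
      intro y hy0
      have hneg : Tendsto (fun ε : ℝ => -ε) (nhdsWithin 0 (Set.Ioi 0))
          (nhdsWithin 0 (Set.Iio 0)) := by
        simpa using tendsto_neg_nhdsGT (a := (0 : ℝ))
      refine ((hasDerivAt_limitCdf hav0 hav1 hy0.le).tendsto_slope_zero_left.comp hneg).congr
        fun ε => ?_
      simp only [Function.comp, smul_eq_mul, inv_neg, ← sub_eq_add_neg]
      rw [div_eq_inv_mul]
      ring
    exact tendsto_limsup_ratio_sub (s := fun ε => ε)
      (eventually_mem_nhdsWithin.mono fun ε hε => ne_of_gt hε)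
      (lim y₂ (by linarith) h1) (lim y₁ h0 (by linarith)) (slope y₂ (by linarith)) (slope y₁ h0)
      (mallowsU_pos hav0 hav1 h0.le).ne'
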